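/- Let G = (V,E) be an infinite, connected, locally finite graph, fix γ > 1 and set L_0 = 10000, L_{k+1} = L_k^γ. Let x ∈ V and let σ : ℕ → V be a geodesic ray with σ(0) = x, i.e. d(σ(i),σ(j)) = |i−j| for all i,j. For k ≥ 1 and integers 0 ≤ i ≤ ⌊L_{k+1}/L_k⌋ set x_{k,i} = σ(⌊ i·L_k/6 ⌋). Let k_o ≥ 1 be such that 2000·L_k < L_{k+1} for all k ≥ k_o, and let ω : V → {0,1} be a configuration such that for every k ≥ k_o and every integer 0 ≤ i ≤ ⌊L_{k+1}/L_k⌋ the separation event S(x_{k,i}, L_k) does NOT occur. Then the configuration ω has exactly one infinite open cluster C_∞, and moreover either x ∈ C_∞ or diam(C_x) ≤ L_{k_o}, where C_x is the open cluster containing x. -/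

import Mathlib

open MeasureTheory Filter

universe u

variable {V : Type u}

/-- The set of vertices within graph distance `r` of `x`. -/
def gball (G : SimpleGraph V) (x : V) (r : ℝ) : Set V :=
  {y | ∃ p : G.Walk x y, (p.length : ℝ) ≤ r}

/-- The `r`-neighborhood `B(K, r)` of a set `K`. -/
def gnbhd (G : SimpleGraph V) (K : Set V) (r : ℝ) : Set V :=
  {y | ∃ x ∈ K, y ∈ gball G x r}

/-- The edge boundary of `A` relative to `B`, encoded as ordered pairs
`(a, b)` with `a ∈ A`, `b ∈ B \ A` and `a ~ b`. -/
def relBoundary (G : SimpleGraph V) (A B : Set V) : Set (V × V) :=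
  {e | G.Adj e.1 e.2 ∧ e.1 ∈ A ∧ e.2 ∈ B ∧ e.2 ∉ A}

/-- The edge boundary of `A`, encoded as ordered pairs `(a, b)` with
`a ∈ A`, `b ∉ A` and `a ~ b`. -/
def bdry (G : SimpleGraph V) (A : Set V) : Set (V × V) :=
  {e | G.Adj e.1 e.2 ∧ e.1 ∈ A ∧ e.2 ∉ A}

/-- The local isoperimetric inequality `L(dᵢ, cᵢ)`. -/
def LocalIso (G : SimpleGraph V) (di ci : ℝ) : Prop :=
  ∀ (x : V) (r : ℝ), 1 ≤ r → ∀ A : Set V, A ⊆ gball G x r →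
    (A.ncard : ℝ) ≤ (gball G x r).ncard / 2 →
    ci * (A.ncard : ℝ) ^ ((di - 1) / di) ≤ ((relBoundary G A (gball G x r)).ncard : ℝ)

/-- The volume upper bound `𝒱ᵤ(dᵤ, cᵤ)`. -/
def VolUpper (G : SimpleGraph V) (du cu : ℝ) : Prop :=
  ∀ (x : V) (r : ℝ), 1 ≤ r →
    (gball G x r).Finite ∧ ((gball G x r).ncard : ℝ) ≤ cu * r ^ du

/-- The volume lower bound `𝒱ₗ(dₗ, cₗ)`. -/
def VolLower (G : SimpleGraph V) (dl cl : ℝ) : Prop :=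
  ∀ (x : V) (r : ℝ), 1 ≤ r → cl * r ^ dl ≤ ((gball G x r).ncard : ℝ)

/-- Every walk from `y` to `z` has length at least `t`; equivalently the graph
distance from `y` to `z` (with value `∞` if unreachable) is at least `t`. -/
def distGE (G : SimpleGraph V) (y z : V) (t : ℝ) : Prop :=
  ∀ p : G.Walk y z, t ≤ (p.length : ℝ)

/-- The distance between the sets `A` and `B` is at least `t`. -/
def setDistGE (G : SimpleGraph V) (A B : Set V) (t : ℝ) : Prop :=
  ∀ a ∈ A, ∀ b ∈ B, distGE G a b t

/-- The diameter of `A` is at least `t`. -/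
def diamGE (G : SimpleGraph V) (A : Set V) (t : ℝ) : Prop :=
  ∃ y ∈ A, ∃ z ∈ A, distGE G y z t

/-- The diameter of `A` is at most `t`. -/
def diamLE (G : SimpleGraph V) (A : Set V) (t : ℝ) : Prop :=
  ∀ y ∈ A, ∀ z ∈ A, ∃ p : G.Walk y z, (p.length : ℝ) ≤ t

/-- `A` is a connected set of vertices. -/
def ConnSet (G : SimpleGraph V) (A : Set V) : Prop := (G.induce A).Connected

/-- There is an open path, all of whose vertices lie in `S`, connecting `A` to `A'`:
its first vertex lies in `B(A,1)` and its last vertex in `B(A',1)`. -/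
def ConnectsIn (G : SimpleGraph V) (ω : V → Bool) (A A' S : Set V) : Prop :=
  ∃ (a b : V) (p : G.Walk a b), a ∈ gnbhd G A 1 ∧ b ∈ gnbhd G A' 1 ∧
    (∀ v ∈ p.support, v ∈ S) ∧ (∀ v ∈ p.support, ω v = true)

/-- The separation event `𝒮(x, L)`. -/
def sep (G : SimpleGraph V) (ω : V → Bool) (x : V) (L : ℝ) : Prop :=
  ∃ A B : Set V, A ⊆ gball G x (3 * L / 6) ∧ B ⊆ gball G x (3 * L / 6) ∧
    ConnSet G A ∧ ConnSet G B ∧ setDistGE G A B 2 ∧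
    diamGE G A (L / 100) ∧ diamGE G B (L / 100) ∧
    ¬ ConnectsIn G ω A B (gball G x L)

/-- The open cluster `𝒞ₓ` of `x` (empty when `x` is closed). -/
def openCluster (G : SimpleGraph V) (ω : V → Bool) (x : V) : Set V :=
  {y | ω x = true ∧ ∃ p : G.Walk x y, ∀ v ∈ p.support, ω v = true}

/-- There is exactly one infinite open cluster. -/
def UniqueInfCluster (G : SimpleGraph V) (ω : V → Bool) : Prop :=
  (∃ x, (openCluster G ω x).Infinite) ∧
    ∀ x y, (openCluster G ω x).Infinite → (openCluster G ω y).Infinite →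
      openCluster G ω x = openCluster G ω y

/-- `P` is the Bernoulli product measure on `{0,1}^V` with parameter `p`, characterized by
its values on cylinder events. -/
def IsBernoulli (P : Measure (V → Bool)) (p : ℝ) : Prop :=
  ∀ (F : Finset V) (η : V → Bool),
    P {ω | ∀ x ∈ F, ω x = η x} =
      ENNReal.ofReal (p ^ (F.filter fun x => η x = true).card *
        (1 - p) ^ (F.filter fun x => η x = false).card)

/-- A decreasing event. -/
def DecreasingEvent (E : Set (V → Bool)) : Prop :=
  ∀ ω ∈ E, ∀ ω' : V → Bool, (∀ x, ω' x ≤ ω x) → ω' ∈ E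

/-- The σ-algebra `σ(Y_z ; z ∈ S)` generated by the coordinates in `S`. -/
def cylσ (S : Set V) : MeasurableSpace (V → Bool) :=
  MeasurableSpace.comap (fun ω => S.restrict ω) MeasurableSpace.pi

/-- The decoupling inequality `𝒟(α, c_α)`. -/
def Decoupling (G : SimpleGraph V) (P : Measure (V → Bool)) (α cα : ℝ) : Prop :=
  ∀ (x : V) (r : ℝ), 1 ≤ r → ∀ E E' : Set (V → Bool),
    DecreasingEvent E → DecreasingEvent E' →
    MeasurableSet[cylσ (gball G x r)] E →
    MeasurableSet[cylσ (gball G x (2 * r))ᶜ] E' →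
    P (E ∩ E') ≤ P E * P E' + ENNReal.ofReal (cα * r ^ (-α))

/-- The scales `L₀ = 10000`, `L_{k+1} = L_k ^ γ`. -/
noncomputable def Lseq (γ : ℝ) : ℕ → ℝ
  | 0 => 10000
  | k + 1 => Lseq γ k ^ γ

/-- open reachability -/
def OR (G : SimpleGraph V) (ω : V → Bool) (y z : V) : Prop :=
  ∃ p : G.Walk y z, ∀ v ∈ p.support, ω v = true

theorem OR.symm {G : SimpleGraph V} {ω : V → Bool} {y z : V} (h : OR G ω y z) : OR G ω z y := by
  obtain ⟨p, hp⟩ := h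
  exact ⟨p.reverse, fun v hv => hp v (by simpa using hv)⟩

theorem OR.trans {G : SimpleGraph V} {ω : V → Bool} {y z w : V} (h : OR G ω y z)
    (h' : OR G ω z w) : OR G ω y w := by
  obtain ⟨p, hp⟩ := h
  obtain ⟨q, hq⟩ := h'
  refine ⟨p.append q, fun v hv => ?_⟩
  rw [SimpleGraph.Walk.mem_support_append_iff] at hv
  exact hv.elim (hp v) (hq v)

theorem OR.left {G : SimpleGraph V} {ω : V → Bool} {y z : V} (h : OR G ω y z) : ω y = true := by
  obtain ⟨p, hp⟩ := h
  exact hp _ p.start_mem_support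

theorem OR.right {G : SimpleGraph V} {ω : V → Bool} {y z : V} (h : OR G ω y z) : ω z = true :=
  h.symm.left

theorem OR.of_mem {G : SimpleGraph V} {ω : V → Bool} {y z v : V} (p : G.Walk y z)
    (hp : ∀ v ∈ p.support, ω v = true) (hv : v ∈ p.support) : OR G ω y v := by
  classical
  exact ⟨p.takeUntil v hv, fun u hu => hp u (p.support_takeUntil_subset_support hv hu)⟩

theorem OR.near {G : SimpleGraph V} {ω : V → Bool} {y z : V} (p : G.Walk y z)
    (hp : p.length < 2) (hy : ω y = true) (hz : ω z = true) : OR G ω y z := by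
  refine ⟨p, fun v hv => ?_⟩
  cases p with
  | nil => simp at hv; subst hv; exact hy
  | cons h q =>
    cases q with
    | nil => simp at hv; rcases hv with rfl | rfl <;> assumption
    | cons h' q' => simp at hp

theorem dtri {G : SimpleGraph V} (hc : G.Connected) (u v w : V) :
    (G.dist u w : ℝ) ≤ G.dist u v + G.dist v w := by
  exact_mod_cast hc.dist_triangle

theorem mem_gball {G : SimpleGraph V} (hc : G.Connected) {u v : V} {r : ℝ} :
    v ∈ gball G u r ↔ (G.dist u v : ℝ) ≤ r := by
  constructor
  · rintro ⟨p, hp⟩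
    have : (G.dist u v : ℝ) ≤ p.length := by exact_mod_cast G.dist_le p
    linarith
  · intro h
    obtain ⟨p, hp⟩ := hc.exists_walk_length_eq_dist u v
    exact ⟨p, by rw [hp]; exact h⟩

theorem distGE_of {G : SimpleGraph V} {u v : V} {r : ℝ} (h : r ≤ (G.dist u v : ℝ)) :
    distGE G u v r := by
  intro p
  have : (G.dist u v : ℝ) ≤ p.length := by exact_mod_cast G.dist_le p
  linarith

theorem trim_aux {G : SimpleGraph V} (hc : G.Connected) (ω : V → Bool) (z : V) (n : ℕ)
    {u w : V} (p : G.Walk u w) :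
    (∀ v ∈ p.support, ω v = true) → n ≤ G.dist z w →
    (∃ q : G.Walk z u, ∀ v ∈ q.support, ω v = true ∧ G.dist z v ≤ n) →
    ∃ (v : V) (q : G.Walk z v), n ≤ G.dist z v ∧
      ∀ v ∈ q.support, ω v = true ∧ G.dist z v ≤ n := by
  induction p with
  | nil =>
    rintro _ h ⟨q, hq⟩
    exact ⟨_, q, h, hq⟩
  | @cons u u' w h p ih =>
    rintro ho hn ⟨q, hq⟩
    by_cases hu : n ≤ G.dist z u
    · exact ⟨_, q, hu, hq⟩
    · apply ih (fun v hv => ho v (by simp [hv])) hn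
      refine ⟨q.concat h, fun v hv => ?_⟩
      rw [SimpleGraph.Walk.support_concat] at hv
      simp at hv
      rcases hv with hv | rfl
      · exact hq v hv
      · refine ⟨ho _ (by simp), ?_⟩
        have h1 := hc.dist_triangle (u := z) (v := u) (w := v)
        have h2 := SimpleGraph.dist_eq_one_iff_adj.2 h
        omega

theorem trim {G : SimpleGraph V} (hc : G.Connected) {ω : V → Bool} {z w : V} (h : OR G ω z w)
    (n : ℕ) (hn : n ≤ G.dist z w) :
    ∃ (v : V) (q : G.Walk z v), n ≤ G.dist z v ∧
      ∀ v ∈ q.support, ω v = true ∧ G.dist z v ≤ n := by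
  obtain ⟨p, hp⟩ := h
  refine trim_aux hc ω z n p hp hn ⟨SimpleGraph.Walk.nil, ?_⟩
  intro v hv
  simp at hv
  subst hv
  exact ⟨hp _ p.start_mem_support, by simp⟩

theorem join {G : SimpleGraph V} (hc : G.Connected) {ω : V → Bool} {c : V} {L : ℝ}
    (hL : 10000 ≤ L) (hs : ¬ sep G ω c L) {z w z' w' : V}
    (h : OR G ω z w) (hd : L / 100 ≤ G.dist z w) (hz : (G.dist c z : ℝ) ≤ L / 3)
    (h' : OR G ω z' w') (hd' : L / 100 ≤ G.dist z' w') (hz' : (G.dist c z' : ℝ) ≤ L / 3) :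
    OR G ω z z' := by
  have hn1 : L / 100 ≤ (⌈L / 100⌉₊ : ℝ) := Nat.le_ceil _
  have hn2 : (⌈L / 100⌉₊ : ℝ) < L / 100 + 1 := Nat.ceil_lt_add_one (by linarith)
  obtain ⟨v, q, hv, hq⟩ := trim hc h ⌈L / 100⌉₊ (Nat.ceil_le.2 hd)
  obtain ⟨v', q', hv', hq'⟩ := trim hc h' ⌈L / 100⌉₊ (Nat.ceil_le.2 hd')
  have hA : ∀ u ∈ q.support, OR G ω z u := fun u hu => OR.of_mem q (fun v hv => (hq v hv).1) hu
  have hB : ∀ u ∈ q'.support, OR G ω z' u := fun u hu => OR.of_mem q' (fun v hv => (hq' v hv).1) hu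
  by_contra hcon
  have key : ∀ a ∈ q.support, ∀ b ∈ q'.support, ¬ OR G ω a b := by
    intro a ha b hb hab
    exact hcon (((hA a ha).trans hab).trans (hB b hb).symm)
  apply hs
  refine ⟨{u | u ∈ q.support}, {u | u ∈ q'.support}, ?_, ?_, q.connected_induce_support,
    q'.connected_induce_support, ?_, ⟨z, q.start_mem_support, v, q.end_mem_support, ?_⟩,
    ⟨z', q'.start_mem_support, v', q'.end_mem_support, ?_⟩, ?_⟩
  · intro u hu
    rw [mem_gball hc]
    have h1 : (G.dist z u : ℝ) ≤ ⌈L / 100⌉₊ := by exact_mod_cast (hq u hu).2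
    linarith [dtri hc c z u]
  · intro u hu
    rw [mem_gball hc]
    have h1 : (G.dist z' u : ℝ) ≤ ⌈L / 100⌉₊ := by exact_mod_cast (hq' u hu).2
    linarith [dtri hc c z' u]
  · intro a ha b hb p
    by_contra hlt
    push Not at hlt
    exact key a ha b hb (OR.near p (by exact_mod_cast hlt) (hA a ha).right (hB b hb).right)
  · apply distGE_of
    have : (⌈L / 100⌉₊ : ℝ) ≤ G.dist z v := by exact_mod_cast hv
    linarith
  · apply distGE_of
    have : (⌈L / 100⌉₊ : ℝ) ≤ G.dist z' v' := by exact_mod_cast hv'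
    linarith
  · rintro ⟨a, b, p, ⟨a0, ha0, pa, hpa⟩, ⟨b0, hb0, pb, hpb⟩, -, hop⟩
    have hab : OR G ω a b := ⟨p, hop⟩
    have hpa' : pa.length ≤ 1 := by exact_mod_cast hpa
    have hpb' : pb.length ≤ 1 := by exact_mod_cast hpb
    have h1 := OR.near pa (by omega) (hA a0 ha0).right hab.left
    have h2 := OR.near pb (by omega) (hB b0 hb0).right hab.right
    exact key a0 ha0 b0 hb0 ((h1.trans hab).trans h2.symm)

theorem seg {G : SimpleGraph V} {σ : ℕ → V}
    (hgeo : ∀ i j : ℕ, (G.dist (σ i) (σ j) : ℤ) = |(i : ℤ) - (j : ℤ)|) (m n : ℕ) :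
    ∃ p : G.Walk (σ m) (σ (m + n)), ∀ v ∈ p.support, ∃ j ≤ n, v = σ (m + j) := by
  induction n with
  | zero => exact ⟨SimpleGraph.Walk.nil, fun v hv => ⟨0, le_rfl, by simpa using hv⟩⟩
  | succ n ih =>
    obtain ⟨p, hp⟩ := ih
    have hadj : G.Adj (σ (m + n)) (σ (m + (n + 1))) := by
      rw [← SimpleGraph.dist_eq_one_iff_adj]
      have := hgeo (m + n) (m + (n + 1))
      push_cast at this
      rw [show ((m : ℤ) + n - (m + (n + 1))) = -1 by ring] at this
      simpa using this
    refine ⟨p.concat hadj, fun v hv => ?_⟩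
    rw [SimpleGraph.Walk.support_concat] at hv
    simp at hv
    rcases hv with hv | rfl
    · obtain ⟨j, hj, rfl⟩ := hp v hv
      exact ⟨j, by omega, rfl⟩
    · exact ⟨n + 1, le_rfl, rfl⟩

theorem exists_big {G : SimpleGraph V} (hc : G.Connected) {ω : V → Bool} {σ : ℕ → V}
    (hgeo : ∀ i j : ℕ, (G.dist (σ i) (σ j) : ℤ) = |(i : ℤ) - (j : ℤ)|) {m : ℕ} {L : ℝ}
    (hL : 10000 ≤ L) (hs : ¬ sep G ω (σ m) L) :
    ∃ z w, OR G ω z w ∧ L / 100 ≤ G.dist z w ∧ (G.dist (σ m) z : ℝ) ≤ L / 50 := by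
  have hg : ∀ i j : ℕ, (G.dist (σ i) (σ (i + j))) = j := by
    intro i j
    have := hgeo i (i + j)
    push_cast at this
    rw [show ((i : ℤ) - (i + j)) = -j by ring, abs_neg, Nat.abs_cast] at this
    exact_mod_cast this
  obtain ⟨n, hn⟩ : ∃ n, n = ⌈L / 100⌉₊ := ⟨_, rfl⟩
  have hn1 : L / 100 ≤ (n : ℝ) := hn ▸ Nat.le_ceil _
  have hn2 : (n : ℝ) < L / 100 + 1 := hn ▸ Nat.ceil_lt_add_one (by linarith)
  obtain ⟨p, hp⟩ := seg hgeo m n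
  obtain ⟨q, hq⟩ := seg hgeo (m + 3 * n) n
  have hn3 : 100 ≤ n := by
    have : (100 : ℝ) ≤ n := by linarith
    exact_mod_cast this
  have hpq : ∀ a ∈ p.support, ∀ b ∈ q.support, 2 * n ≤ G.dist a b := by
    intro a ha b hb
    obtain ⟨i, hi, rfl⟩ := hp a ha
    obtain ⟨j, hj, rfl⟩ := hq b hb
    have := hg (m + i) (3 * n + j - i)
    rw [show m + i + (3 * n + j - i) = m + 3 * n + j by omega] at this
    omega
  have hconn : ConnectsIn G ω {u | u ∈ p.support} {u | u ∈ q.support} (gball G (σ m) L) := by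
    by_contra hcon
    apply hs
    refine ⟨{u | u ∈ p.support}, {u | u ∈ q.support}, ?_, ?_, p.connected_induce_support,
      q.connected_induce_support, ?_, ⟨_, p.start_mem_support, _, p.end_mem_support, ?_⟩,
      ⟨_, q.start_mem_support, _, q.end_mem_support, ?_⟩, hcon⟩
    · intro u hu
      obtain ⟨i, hi, rfl⟩ := hp u hu
      rw [mem_gball hc, hg]
      have : (i : ℝ) ≤ n := by exact_mod_cast hi
      linarith
    · intro u hu
      obtain ⟨i, hi, rfl⟩ := hq u hu
      rw [mem_gball hc, add_assoc, hg]
      have : (i : ℝ) ≤ n := by exact_mod_cast hi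
      push_cast
      linarith
    · intro a ha b hb
      apply distGE_of
      have := hpq a ha b hb
      have h2 : 2 ≤ G.dist a b := by omega
      exact_mod_cast h2
    · apply distGE_of
      rw [hg]
      exact hn1
    · apply distGE_of
      rw [hg]
      exact hn1
  obtain ⟨a, b, r, ⟨a0, ha0, pa, hpa⟩, ⟨b0, hb0, pb, hpb⟩, -, hop⟩ := hconn
  have h1 : G.dist a0 a ≤ 1 := (G.dist_le pa).trans (by exact_mod_cast hpa)
  have h2 : G.dist b0 b ≤ 1 := (G.dist_le pb).trans (by exact_mod_cast hpb)
  have h3 := hpq a0 ha0 b0 hb0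
  have h4 := hc.dist_triangle (u := a0) (v := a) (w := b0)
  have h5 := hc.dist_triangle (u := a) (v := b) (w := b0)
  rw [SimpleGraph.dist_comm (u := b) (v := b0)] at h5
  have h6 : n ≤ G.dist a b := by omega
  obtain ⟨i, hi, rfl⟩ := hp a0 ha0
  have h7 := hc.dist_triangle (u := σ m) (v := σ (m + i)) (w := a)
  rw [hg] at h7
  have h8 : G.dist (σ m) a ≤ n + 1 := by omega
  have h6' : (n : ℝ) ≤ G.dist a b := by exact_mod_cast h6
  have h8' : (G.dist (σ m) a : ℝ) ≤ n + 1 := by exact_mod_cast h8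
  exact ⟨a, b, ⟨r, hop⟩, by linarith, by linarith⟩

theorem ball_fin {G : SimpleGraph V} (hc : G.Connected)
    (hlf : ∀ v : V, (G.neighborSet v).Finite) (x : V) (n : ℕ) : {v | G.dist x v ≤ n}.Finite := by
  induction n with
  | zero =>
    refine (Set.finite_singleton x).subset fun v hv => ?_
    have h0 : G.dist x v = 0 := by simpa using hv
    exact ((hc.dist_eq_zero_iff).1 h0).symm
  | succ n ih =>
    refine (ih.union (ih.biUnion fun v _ => hlf v)).subset fun v hv => ?_
    obtain ⟨p, hp⟩ := hc.exists_walk_length_eq_dist v x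
    rw [SimpleGraph.dist_comm] at hp
    have hv' : G.dist x v ≤ n + 1 := hv
    cases p with
    | nil => left; simp
    | @cons _ u _ h q =>
      right
      simp only [Set.mem_iUnion]
      simp at hp
      refine ⟨u, ?_, h.symm⟩
      have := G.dist_le q
      rw [SimpleGraph.dist_comm] at this
      show G.dist x u ≤ n
      omega

theorem cluster_far {G : SimpleGraph V} (hc : G.Connected)
    (hlf : ∀ v : V, (G.neighborSet v).Finite) {ω : V → Bool} {y : V}
    (h : (openCluster G ω y).Infinite) (t : ℝ) : ∃ w, OR G ω y w ∧ t ≤ G.dist y w := by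
  by_contra hcon
  push Not at hcon
  apply h
  refine (ball_fin hc hlf y ⌈t⌉₊).subset fun v hv => ?_
  have := hcon v hv.2
  have h2 : (G.dist y v : ℝ) ≤ ⌈t⌉₊ := this.le.trans (Nat.le_ceil _)
  exact_mod_cast h2

theorem far_cluster {G : SimpleGraph V} (hc : G.Connected) {ω : V → Bool} {y : V}
    (h : ∀ t : ℝ, ∃ u w, OR G ω y u ∧ OR G ω u w ∧ t ≤ G.dist u w) :
    (openCluster G ω y).Infinite := by
  intro hf
  obtain ⟨M, hM⟩ := (hf.image (fun v => G.dist y v)).bddAbove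
  obtain ⟨u, w, hu, hw, hd⟩ := h (2 * M + 1)
  have h1 : G.dist y u ≤ M := hM ⟨u, ⟨hu.left, hu⟩, rfl⟩
  have h2 : G.dist y w ≤ M := hM ⟨w, ⟨hu.left, hu.trans hw⟩, rfl⟩
  have h3 := hc.dist_triangle (u := u) (v := y) (w := w)
  rw [SimpleGraph.dist_comm (u := u) (v := y)] at h3
  have h4 : 2 * M + 1 ≤ G.dist u w := by exact_mod_cast hd
  omega

theorem Lseq_ge {γ : ℝ} (hγ : 1 < γ) (k : ℕ) : 10000 ≤ Lseq γ k := by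
  induction k with
  | zero => exact le_rfl
  | succ k ih =>
    have : Lseq γ k ^ (1 : ℝ) ≤ Lseq γ k ^ γ :=
      Real.rpow_le_rpow_of_exponent_le (by linarith) hγ.le
    rw [Real.rpow_one] at this
    exact ih.trans this

theorem OR.cluster_eq {G : SimpleGraph V} {ω : V → Bool} {y z : V} (h : OR G ω y z) :
    openCluster G ω y = openCluster G ω z := by
  ext v
  constructor
  · rintro ⟨-, hv⟩
    exact ⟨h.right, h.symm.trans hv⟩
  · rintro ⟨-, hv⟩
    exact ⟨h.left, h.trans hv⟩

/-- if no separation event occurs along a geodesic ray at any scale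
`k ≥ k_o`, then there is exactly one infinite open cluster, and moreover `x` belongs to
it or `diam(C_x) ≤ L_{k_o}`. -/
theorem statement15 {V : Type u} (G : SimpleGraph V) [Infinite V] (hconn : G.Connected)
    (hlf : ∀ v : V, (G.neighborSet v).Finite) (γ : ℝ) (hγ : 1 < γ)
    (x : V) (σ : ℕ → V) (hσ0 : σ 0 = x)
    (hgeo : ∀ i j : ℕ, (G.dist (σ i) (σ j) : ℤ) = |(i : ℤ) - (j : ℤ)|)
    (ko : ℕ) (hko : 1 ≤ ko)
    (hscale : ∀ k, ko ≤ k → 2000 * Lseq γ k < Lseq γ (k + 1))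
    (ω : V → Bool)
    (hnosep : ∀ k, ko ≤ k → ∀ i : ℕ, i ≤ ⌊Lseq γ (k + 1) / Lseq γ k⌋₊ →
      ¬ sep G ω (σ ⌊(i : ℝ) * Lseq γ k / 6⌋₊) (Lseq γ k)) :
    UniqueInfCluster G ω ∧
      ((openCluster G ω x).Infinite ∨ diamLE G (openCluster G ω x) (Lseq γ ko)) := by
  have hL : ∀ k, 10000 ≤ Lseq γ k := Lseq_ge hγ
  have hx : ∀ L : ℝ, σ ⌊((0 : ℕ) : ℝ) * L / 6⌋₊ = x := by
    intro L; simp [hσ0]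
  have hns0 : ∀ k, ko ≤ k → ¬ sep G ω x (Lseq γ k) := by
    intro k hk
    have := hnosep k hk 0 (Nat.zero_le _)
    rwa [hx] at this
  -- big sets along the ray
  have hbig : ∀ k i, ∃ z w, ko ≤ k → i ≤ ⌊Lseq γ (k + 1) / Lseq γ k⌋₊ →
      OR G ω z w ∧ Lseq γ k / 100 ≤ G.dist z w ∧
      (G.dist (σ ⌊(i : ℝ) * Lseq γ k / 6⌋₊) z : ℝ) ≤ Lseq γ k / 50 := by
    intro k i
    by_cases h : ko ≤ k ∧ i ≤ ⌊Lseq γ (k + 1) / Lseq γ k⌋₊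
    · obtain ⟨z, w, h1⟩ := exists_big hconn hgeo (hL k) (hnosep k h.1 i h.2)
      exact ⟨z, w, fun _ _ => h1⟩
    · exact ⟨x, x, fun h1 h2 => absurd ⟨h1, h2⟩ h⟩
  choose z w hzw using hbig
  have hchain : ∀ k, ko ≤ k → ∀ i, i ≤ ⌊Lseq γ (k + 1) / Lseq γ k⌋₊ →
      OR G ω (z k 0) (z k i) := by
    intro k hk i
    induction i with
    | zero =>
      intro h
      have := (hzw k 0 hk h).1
      exact this.trans this.symm
    | succ i ih =>
      intro h
      have hi : i ≤ ⌊Lseq γ (k + 1) / Lseq γ k⌋₊ := by omega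
      obtain ⟨a1, a2, a3⟩ := hzw k i hk hi
      obtain ⟨b1, b2, b3⟩ := hzw k (i + 1) hk h
      refine (ih hi).trans (join hconn (hL k) (hnosep k hk i hi) a1 a2 ?_ b1 b2 ?_)
      · linarith [hL k]
      · have t := dtri hconn (σ ⌊(i : ℝ) * Lseq γ k / 6⌋₊)
          (σ ⌊((i + 1 : ℕ) : ℝ) * Lseq γ k / 6⌋₊) (z k (i + 1))
        have hLk := hL k
        have i0 : (0 : ℝ) ≤ i := Nat.cast_nonneg _
        have f1 := Nat.floor_le (show (0 : ℝ) ≤ ((i + 1 : ℕ) : ℝ) * Lseq γ k / 6 by positivity)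
        have f2 := Nat.lt_floor_add_one ((i : ℝ) * Lseq γ k / 6)
        have f3 : ⌊(i : ℝ) * Lseq γ k / 6⌋₊ ≤ ⌊((i + 1 : ℕ) : ℝ) * Lseq γ k / 6⌋₊ := by
          apply Nat.floor_le_floor
          push_cast
          linarith
        have g := hgeo ⌊(i : ℝ) * Lseq γ k / 6⌋₊ ⌊((i + 1 : ℕ) : ℝ) * Lseq γ k / 6⌋₊
        have f3' : (⌊(i : ℝ) * Lseq γ k / 6⌋₊ : ℤ) ≤ ⌊((i + 1 : ℕ) : ℝ) * Lseq γ k / 6⌋₊ := by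
          exact_mod_cast f3
        rw [abs_sub_comm, abs_of_nonneg (by linarith)] at g
        have g' : (G.dist (σ ⌊(i : ℝ) * Lseq γ k / 6⌋₊)
          (σ ⌊((i + 1 : ℕ) : ℝ) * Lseq γ k / 6⌋₊) : ℝ) =
            (⌊((i + 1 : ℕ) : ℝ) * Lseq γ k / 6⌋₊ : ℝ) - (⌊(i : ℝ) * Lseq γ k / 6⌋₊ : ℝ) := by
          exact_mod_cast g
        have e : ((i + 1 : ℕ) : ℝ) * Lseq γ k / 6 = (i : ℝ) * Lseq γ k / 6 + Lseq γ k / 6 := by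
          push_cast; ring
        linarith
  have hz0 : ∀ k, ko ≤ k → OR G ω (z k 0) (w k 0) ∧ Lseq γ k / 100 ≤ G.dist (z k 0) (w k 0) ∧
      (G.dist x (z k 0) : ℝ) ≤ Lseq γ k / 50 := by
    intro k hk
    have := hzw k 0 hk (Nat.zero_le _)
    rwa [hx] at this
  -- anything big near x joins
  have hjoin : ∀ k, ko ≤ k → ∀ u v, OR G ω u v → Lseq γ k / 100 ≤ G.dist u v →
      (G.dist x u : ℝ) ≤ Lseq γ k / 3 → OR G ω u (z k 0) := by
    intro k hk u v h1 h2 h3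
    obtain ⟨a1, a2, a3⟩ := hz0 k hk
    exact join hconn (hL k) (hns0 k hk) h1 h2 h3 a1 a2 (by linarith [hL k])
  have hlink : ∀ k, ko ≤ k → OR G ω (z k 0) (z (k + 1) 0) := by
    intro k hk
    obtain ⟨N, hN⟩ : ∃ N, N = ⌊Lseq γ (k + 1) / Lseq γ k⌋₊ := ⟨_, rfl⟩
    have hLk := hL k
    have hsc := hscale k hk
    obtain ⟨a1, a2, a3⟩ := hz0 k hk
    obtain ⟨b1, b2, b3⟩ := hzw k N hk hN.le
    refine hjoin (k + 1) (by omega) _ _ (hchain k hk N hN.le) ?_ (by linarith)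
    have f1 := Nat.lt_floor_add_one (Lseq γ (k + 1) / Lseq γ k)
    rw [← hN, div_lt_iff₀ (by linarith)] at f1
    have f2 := Nat.lt_floor_add_one ((N : ℝ) * Lseq γ k / 6)
    have g := hgeo 0 ⌊(N : ℝ) * Lseq γ k / 6⌋₊
    rw [hσ0, abs_sub_comm] at g
    have g' : G.dist x (σ ⌊(N : ℝ) * Lseq γ k / 6⌋₊) = ⌊(N : ℝ) * Lseq γ k / 6⌋₊ := by
      simpa using g
    have g2 : (G.dist x (σ ⌊(N : ℝ) * Lseq γ k / 6⌋₊) : ℝ) = (⌊(N : ℝ) * Lseq γ k / 6⌋₊ : ℝ) := by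
      exact_mod_cast g'
    have t1 := dtri hconn x (z k 0) (σ ⌊(N : ℝ) * Lseq γ k / 6⌋₊)
    have t2 := dtri hconn (z k 0) (z k N) (σ ⌊(N : ℝ) * Lseq γ k / 6⌋₊)
    rw [SimpleGraph.dist_comm (u := z k N)] at t2
    linarith
  have hlinks : ∀ j, OR G ω (z ko 0) (z (ko + j) 0) := by
    intro j
    induction j with
    | zero => exact (hz0 ko le_rfl).1.trans (hz0 ko le_rfl).1.symm
    | succ j ih => exact ih.trans (hlink (ko + j) (by omega))
  have hgrow : ∀ j : ℕ, (j : ℝ) ≤ Lseq γ (ko + j) := by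
    intro j
    induction j with
    | zero => simp; linarith [hL ko]
    | succ j ih =>
      have := hscale (ko + j) (by omega)
      have h2 := hL (ko + j)
      rw [← add_assoc]
      push_cast
      linarith
  have hinf : (openCluster G ω (z ko 0)).Infinite := by
    apply far_cluster hconn
    intro t
    obtain ⟨j, hj⟩ := exists_nat_ge (100 * t)
    refine ⟨z (ko + j) 0, w (ko + j) 0, hlinks j, (hz0 _ (by omega)).1, ?_⟩
    have := (hz0 (ko + j) (by omega)).2.1
    linarith [hgrow j]
  have huniq : ∀ y, (openCluster G ω y).Infinite →
      openCluster G ω y = openCluster G ω (z ko 0) := by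
    intro y hy
    obtain ⟨j, hj⟩ := exists_nat_ge (3 * (G.dist x y : ℝ))
    obtain ⟨v, h1, h2⟩ := cluster_far hconn hlf hy (Lseq γ (ko + j) / 100)
    have := hjoin (ko + j) (by omega) y v h1 h2 (by linarith [hgrow j])
    exact (this.trans (hlinks j).symm).cluster_eq
  refine ⟨⟨⟨_, hinf⟩, fun y y' h h' => (huniq y h).trans (huniq y' h').symm⟩, ?_⟩
  by_cases hd : diamLE G (openCluster G ω x) (Lseq γ ko)
  · exact Or.inr hd
  left
  have hLk := hL ko
  have hfar : ∃ v, OR G ω x v ∧ Lseq γ ko / 100 ≤ G.dist x v := by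
    by_contra hcon
    push Not at hcon
    apply hd
    intro a ha b hb
    obtain ⟨p, hp⟩ := hconn.exists_walk_length_eq_dist a b
    refine ⟨p, ?_⟩
    rw [hp]
    have t := dtri hconn a x b
    rw [SimpleGraph.dist_comm (u := a) (v := x)] at t
    linarith [hcon a ha.2, hcon b hb.2]
  obtain ⟨v, h1, h2⟩ := hfar
  rw [(hjoin ko le_rfl x v h1 h2 (by simp; linarith)).cluster_eq]
  exact hinf
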